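/- arXiv:2010.05952 — 2 statements merged into one kernel-verified Lean document; each statement's English description precedes it below -/
import Mathlib

section
/- Let H be a real Hilbert space, V ⊆ H a dense linear subspace, and S a continuous symmetric bilinear form on H. Then the Morse index of S on V equals the Morse index of S on H; that is, the supremum of the dimensions of subspaces of V on which S is negative definite equals the supremum of the dimensions of subspaces of H on which S is negative definite. -/
open Topology

variable {H : Type*} [NormedAddCommGroup H] [InnerProductSpace ℝ H]

/-- `S` is negative definite on the submodule `W`. -/
def NegDefOn (S : H →L[ℝ] H →L[ℝ] ℝ) (W : Submodule ℝ H) : Prop :=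
  ∀ w ∈ W, w ≠ 0 → S w w < 0

/-- The Morse index of `S` restricted to the subspace `V`: the supremum of the dimensions of
subspaces of `V` on which `S` is negative definite. -/
noncomputable def morseIndexOn (S : H →L[ℝ] H →L[ℝ] ℝ) (V : Submodule ℝ H) : ℕ∞ :=
  ⨆ W : {W : Submodule ℝ H // W ≤ V ∧ NegDefOn S W}, (Module.rank ℝ W.1).toENat

/-- The radical of `S` restricted to the subspace `V`:
`{u ∈ V | S(u,v) = 0 for all v ∈ V}`. -/
def radicalOn (S : H →L[ℝ] H →L[ℝ] ℝ) (V : Submodule ℝ H) : Submodule ℝ H where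
  carrier := {u | u ∈ V ∧ ∀ v ∈ V, S u v = 0}
  add_mem' := by
    rintro a b ⟨ha, ha'⟩ ⟨hb, hb'⟩
    exact ⟨V.add_mem ha hb, fun v hv => by simp [ha' v hv, hb' v hv]⟩
  zero_mem' := by simp
  smul_mem' := by
    rintro c a ⟨ha, ha'⟩
    exact ⟨V.smul_mem c ha, fun v hv => by simp [ha' v hv]⟩

/-- The nullity of `S` restricted to the subspace `V`: the dimension of the radical. -/
noncomputable def nullityOn (S : H →L[ℝ] H →L[ℝ] ℝ) (V : Submodule ℝ H) : ℕ∞ :=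
  (Module.rank ℝ (radicalOn S V)).toENat

/-- If the quadratic form of `S` is negative on all combinations of `f` with unit coefficients, then the
Morse index of `S` on any subspace containing `f` is at least the length of `f`. -/
theorem natCast_le_morseIndexOn {S : H →L[ℝ] H →L[ℝ] ℝ} {V : Submodule ℝ H} {n : ℕ}
    {f : Fin n → H} (hfV : ∀ i, f i ∈ V)
    (hf : ∀ c ∈ Metric.sphere (0 : Fin n → ℝ) 1, S (∑ i, c i • f i) (∑ i, c i • f i) < 0) :
    (n : ℕ∞) ≤ morseIndexOn S V := by
  have hneg : ∀ c : Fin n → ℝ, c ≠ 0 → S (∑ i, c i • f i) (∑ i, c i • f i) < 0 := by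
    intro c hc
    have hpos : 0 < ‖c‖ := norm_pos_iff.mpr hc
    have h := hf (‖c‖⁻¹ • c) (by simp [norm_smul, hpos.ne'])
    have hsum : ∑ i, (‖c‖⁻¹ • c) i • f i = ‖c‖⁻¹ • ∑ i, c i • f i := by
      simp [Finset.smul_sum, mul_smul]
    rw [hsum] at h
    simp only [map_smul, smul_apply, smul_eq_mul] at h
    have hinv : 0 ≤ ‖c‖⁻¹ := (inv_pos.mpr hpos).le
    exact neg_of_mul_neg_right (neg_of_mul_neg_right h hinv) hinv
  have hli : LinearIndependent ℝ f := by
    rw [Fintype.linearIndependent_iff]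
    intro c hc
    by_contra! h
    obtain ⟨i, hi⟩ := h
    have := hneg c fun h0 => hi (by simp [h0])
    simp [hc] at this
  have hW : NegDefOn S (Submodule.span ℝ (Set.range f)) := by
    intro w hw hw0
    obtain ⟨c, rfl⟩ := (Submodule.mem_span_range_iff_exists_fun ℝ).mp hw
    exact hneg c fun h0 => hw0 (by simp [h0])
  have hWV : Submodule.span ℝ (Set.range f) ≤ V :=
    Submodule.span_le.mpr (Set.range_subset_iff.mpr hfV)
  refine le_trans ?_ (le_iSup (fun W : {W : Submodule ℝ H // W ≤ V ∧ NegDefOn S W} =>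
    (Module.rank ℝ W.1).toENat) ⟨_, hWV, hW⟩)
  simpa [rank_span hli] using hli.injective.encard_range

/-- Negativity of the quadratic form of `S` on the unit sphere of coefficients is an open condition
on finite families of vectors. -/
theorem eventually_forall_sphere_neg (S : H →L[ℝ] H →L[ℝ] ℝ) {n : ℕ} {e : Fin n → H}
    (he : ∀ c ∈ Metric.sphere (0 : Fin n → ℝ) 1, S (∑ i, c i • e i) (∑ i, c i • e i) < 0) :
    ∀ᶠ f in 𝓝 e, ∀ c ∈ Metric.sphere (0 : Fin n → ℝ) 1,
      S (∑ i, c i • f i) (∑ i, c i • f i) < 0 := by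
  refine (isCompact_sphere _ _).eventually_forall_of_forall_eventually fun c hc => ?_
  have hcont : Continuous fun z : (Fin n → H) × (Fin n → ℝ) =>
      S (∑ i, z.2 i • z.1 i) (∑ i, z.2 i • z.1 i) := by fun_prop
  exact hcont.continuousAt.eventually_lt_const (he c hc)

/-- Lemma: index on a dense subspace.
The Morse index of a continuous symmetric bilinear form on a dense subspace `V` of a Hilbert
space `H` equals its Morse index on `H`. -/
theorem morseIndex_dense_subspace
    {H : Type*} [NormedAddCommGroup H] [InnerProductSpace ℝ H] [CompleteSpace H]
    (S : H →L[ℝ] H →L[ℝ] ℝ) (hsymm : ∀ u v : H, S u v = S v u)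
    (V : Submodule ℝ H) (hV : Dense (V : Set H)) :
    morseIndexOn S V = morseIndexOn S ⊤ := by
  refine le_antisymm ?_ ?_
  · exact iSup_le fun W => le_iSup
      (fun W : {W : Submodule ℝ H // W ≤ ⊤ ∧ NegDefOn S W} => (Module.rank ℝ W.1).toENat)
      ⟨W.1, le_top, W.2.2⟩
  · refine iSup_le fun ⟨W, _, hW⟩ => ENat.forall_natCast_le_iff_le.mp fun n hn => ?_
    obtain ⟨e, he⟩ : ∃ e : Fin n → W, LinearIndependent ℝ e :=
      exists_linearIndependent_of_le_rank (Cardinal.natCast_le_toENat.mp hn)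
    have hneg : ∀ c ∈ Metric.sphere (0 : Fin n → ℝ) 1,
        S (∑ i, c i • (e i : H)) (∑ i, c i • (e i : H)) < 0 := by
      intro c hc
      refine hW _ (W.sum_mem fun i _ => W.smul_mem _ (e i).2) fun h0 => ?_
      have hc0 : c = 0 := funext <| Fintype.linearIndependent_iff.mp
        (he.map' W.subtype W.ker_subtype) c h0
      simp [hc0] at hc
    obtain ⟨f, hf, hfV⟩ := (dense_pi Set.univ fun (_ : Fin n) _ => hV).inter_nhds_nonempty
      (eventually_forall_sphere_neg S hneg)
    exact natCast_le_morseIndexOn (fun i => hf i trivial) hfV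
end

section
/- Let H be a separable real Hilbert space and S a continuous symmetric bilinear form on H with finite Morse index MI(S). For any u ∈ H with S(u,u) < 0, there exists a subspace W of H with u ∈ W, dim W = MI(S), and S negative definite on W. -/
open Topology

variable {H : Type*} [NormedAddCommGroup H] [InnerProductSpace ℝ H]

theorem NegDefOn.sup_span_singleton {S : H →L[ℝ] H →L[ℝ] ℝ} (hsymm : ∀ u v : H, S u v = S v u)
    {W : Submodule ℝ H} (hW : NegDefOn S W) {v : H} (hv : S v v < 0)
    (horth : ∀ w ∈ W, S v w = 0) : NegDefOn S (W ⊔ Submodule.span ℝ {v}) := by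
  intro x hx hx0
  obtain ⟨w, hw, y, hy, rfl⟩ := Submodule.mem_sup.mp hx
  obtain ⟨c, rfl⟩ := Submodule.mem_span_singleton.mp hy
  have hval : S (w + c • v) (w + c • v) = S w w + c ^ 2 * S v v := by
    simp only [map_add, map_smul, add_apply, smul_apply, smul_eq_mul, hsymm w v, horth w hw]
    ring
  rw [hval]
  rcases eq_or_ne w 0 with rfl | hw0
  · have hc : c ≠ 0 := by
      rintro rfl
      simp at hx0
    simpa using mul_neg_of_pos_of_neg (sq_pos_of_ne_zero hc) hv
  · have := mul_nonpos_of_nonneg_of_nonpos (sq_nonneg c) hv.le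
    linarith [hW w hw hw0]

theorem negDefOn_span_singleton {S : H →L[ℝ] H →L[ℝ] ℝ} {u : H} (hu : S u u < 0) :
    NegDefOn S (Submodule.span ℝ {u}) := by
  intro x hx hx0
  obtain ⟨c, rfl⟩ := Submodule.mem_span_singleton.mp hx
  have hc : c ≠ 0 := left_ne_zero_of_smul hx0
  have := mul_neg_of_pos_of_neg (sq_pos_of_ne_zero hc) hu
  simp only [map_smul, smul_apply, smul_eq_mul]
  nlinarith

/-- A finite-dimensional subspace contains a nonzero vector `S`-orthogonal to any given subspace of
smaller dimension. -/
theorem exists_ne_zero_orthogonal_of_finrank_lt (S : H →L[ℝ] H →L[ℝ] ℝ) (V W : Submodule ℝ H)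
    [FiniteDimensional ℝ V] [FiniteDimensional ℝ W]
    (h : Module.finrank ℝ W < Module.finrank ℝ V) :
    ∃ v ∈ V, v ≠ 0 ∧ ∀ w ∈ W, S v w = 0 := by
  let f : V →ₗ[ℝ] Module.Dual ℝ W :=
    { toFun := fun v => (S v).toLinearMap ∘ₗ W.subtype
      map_add' := fun a b => by ext; simp
      map_smul' := fun c a => by ext; simp }
  have hker : LinearMap.ker f ≠ ⊥ :=
    LinearMap.ker_ne_bot_of_finrank_lt (by rwa [Subspace.dual_finrank_eq])
  obtain ⟨v, hv, hv0⟩ := Submodule.exists_mem_ne_zero_of_ne_bot hker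
  exact ⟨v, v.2, by simpa using hv0,
    fun w hw => LinearMap.congr_fun (LinearMap.mem_ker.mp hv) ⟨w, hw⟩⟩

theorem NegDefOn.rank_le_morseIndexOn_top {S : H →L[ℝ] H →L[ℝ] ℝ} {W : Submodule ℝ H}
    (hW : NegDefOn S W) : (Module.rank ℝ W).toENat ≤ morseIndexOn S ⊤ :=
  le_iSup (fun W : {W : Submodule ℝ H // W ≤ ⊤ ∧ NegDefOn S W} => (Module.rank ℝ W.1).toENat)
    ⟨W, le_top, hW⟩

theorem NegDefOn.finiteDimensional {S : H →L[ℝ] H →L[ℝ] ℝ} {W : Submodule ℝ H}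
    (hW : NegDefOn S W) (hfin : morseIndexOn S ⊤ < ⊤) : FiniteDimensional ℝ W :=
  Module.rank_lt_aleph0_iff.mp (Cardinal.toENat_lt_top.mp (hW.rank_le_morseIndexOn_top.trans_lt hfin))

theorem toENat_rank_eq_finrank (W : Submodule ℝ H) [FiniteDimensional ℝ W] :
    (Module.rank ℝ W).toENat = Module.finrank ℝ W := by
  rw [← Module.finrank_eq_rank, Cardinal.toENat_nat]

/-- Lemma: a maximal negative definite subspace containing a given vector.
For any `u` with `S(u,u) < 0` there is a subspace `W` containing `u`, of dimension `MI(S)`,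
on which `S` is negative definite. -/
theorem exists_maximal_negDef_subspace_containing
    {H : Type*} [NormedAddCommGroup H] [InnerProductSpace ℝ H] [CompleteSpace H]
    [TopologicalSpace.SeparableSpace H]
    (S : H →L[ℝ] H →L[ℝ] ℝ) (hsymm : ∀ u v : H, S u v = S v u)
    (hfin : morseIndexOn S ⊤ < ⊤)
    (u : H) (hu : S u u < 0) :
    ∃ W : Submodule ℝ H, u ∈ W ∧ (Module.rank ℝ W).toENat = morseIndexOn S ⊤ ∧
      NegDefOn S W := by
  have hu0 : NegDefOn S (Submodule.span ℝ {u}) := negDefOn_span_singleton hu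
  have : Nonempty {W : Submodule ℝ H // W ≤ ⊤ ∧ NegDefOn S W} := ⟨⟨_, le_top, hu0⟩⟩
  have : Nonempty {W : Submodule ℝ H // u ∈ W ∧ NegDefOn S W} :=
    ⟨⟨_, Submodule.mem_span_singleton_self u, hu0⟩⟩
  obtain ⟨⟨V, _, hV⟩, hVdim⟩ := ENat.exists_eq_iSup_of_lt_top hfin
  obtain ⟨⟨W, huW, hW⟩, hWdim⟩ := ENat.exists_eq_iSup_of_lt_top
    (f := fun W : {W : Submodule ℝ H // u ∈ W ∧ NegDefOn S W} => (Module.rank ℝ W.1).toENat)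
    ((iSup_le fun W => W.2.2.rank_le_morseIndexOn_top).trans_lt hfin)
  refine ⟨W, huW, hW.rank_le_morseIndexOn_top.antisymm ?_, hW⟩
  by_contra! hlt
  have := hV.finiteDimensional hfin
  have := hW.finiteDimensional hfin
  have hVW : Module.finrank ℝ W < Module.finrank ℝ V := by
    have h : (Module.rank ℝ W).toENat < (Module.rank ℝ V).toENat := hlt.trans_eq hVdim.symm
    simpa only [toENat_rank_eq_finrank, Nat.cast_lt] using h
  obtain ⟨v, hvV, hv0, horth⟩ := exists_ne_zero_orthogonal_of_finrank_lt S V W hVW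
  have hvv : S v v < 0 := hV v hvV hv0
  have hvW : v ∉ W := fun hv => hvv.ne (horth v hv)
  have hsup : NegDefOn S (W ⊔ Submodule.span ℝ {v}) := hW.sup_span_singleton hsymm hvv horth
  have hlt' : W < W ⊔ Submodule.span ℝ {v} :=
    left_lt_sup.mpr fun h => hvW (h (Submodule.mem_span_singleton_self v))
  have := hsup.finiteDimensional hfin
  have hle : (Module.rank ℝ ↥(W ⊔ Submodule.span ℝ {v})).toENat ≤ (Module.rank ℝ W).toENat :=
    (le_iSup (fun W : {W : Submodule ℝ H // u ∈ W ∧ NegDefOn S W} => (Module.rank ℝ W.1).toENat)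
      ⟨_, hlt'.le huW, hsup⟩).trans_eq hWdim.symm
  rw [toENat_rank_eq_finrank, toENat_rank_eq_finrank, Nat.cast_le] at hle
  exact (Submodule.finrank_lt_finrank_of_lt hlt').not_ge hle
end
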